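/- arXiv:2007.11844 — 5 statements merged into one kernel-verified Lean document; each statement's English description precedes it below -/
import Mathlib

section
/- Let G ∈ 𝒢₁(n, n−3) with n ≥ 5, let θ be the eigenvalue of ℒ(G) with multiplicity n−3, and let v₁v₂v₃v₄ be an induced path P₄ in G. Then (1 − θ)⁴ · d_{v₁} d_{v₂} d_{v₃} d_{v₄} − (d_{v₁} d_{v₂} + d_{v₃} d_{v₄} + d_{v₁} d_{v₄}) · (1 − θ)² + 1 = 0, where d_{v_i} denotes the degree of v_i in G. -/
open Matrix

/-- The normalized Laplacian matrix of a finite simple graph. -/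
noncomputable def normLap {V : Type*} [Fintype V] [DecidableEq V] (G : SimpleGraph V) [DecidableRel G.Adj] :
    Matrix V V ℝ :=
  Matrix.of fun u v =>
    if u = v then 1
    else if G.Adj u v then -1 / Real.sqrt ((G.degree u : ℝ) * (G.degree v : ℝ))
    else 0

/-- The (geometric) multiplicity of `μ` as an eigenvalue of the matrix `M`. -/
noncomputable def eigMult {V : Type*} [Fintype V] [DecidableEq V]
    (M : Matrix V V ℝ) (μ : ℝ) : ℕ :=
  Module.finrank ℝ (LinearMap.ker (M - μ • (1 : Matrix V V ℝ)).mulVecLin)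

/-- The multiset of eigenvalues (with multiplicity) of a hermitian matrix. -/
noncomputable def eigMultiset {V : Type*} [Fintype V] [DecidableEq V]
    (M : Matrix V V ℝ) : Multiset ℝ :=
  if h : M.IsHermitian then Finset.univ.val.map h.eigenvalues else 0

/-- The second-smallest eigenvalue (counted with multiplicity) of a hermitian matrix. -/
noncomputable def secondSmallestEig {V : Type*} [Fintype V] [DecidableEq V]
    (M : Matrix V V ℝ) : ℝ :=
  ((eigMultiset M).sort (· ≤ ·)).getD 1 0

/-- The independence number of a finite simple graph. -/
noncomputable def indepNum {V : Type*} [Fintype V] (G : SimpleGraph V) : ℕ :=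
  sSup {k | ∃ s : Finset V, (∀ u ∈ s, ∀ v ∈ s, u ≠ v → ¬ G.Adj u v) ∧ s.card = k}

/-- `G ∈ 𝒢₁(n, n-3)`. -/
def memG1Family {V : Type*} [Fintype V] [DecidableEq V]
    (G : SimpleGraph V) [DecidableRel G.Adj] (n : ℕ) : Prop :=
  G.Connected ∧ Fintype.card V = n ∧
    (∃ θ : ℝ, eigMult (normLap G) θ = n - 3) ∧
    secondSmallestEig (normLap G) ≠ 1 ∧
    indepNum G = 2

/-- `v₁v₂v₃v₄` is an induced path `P₄`. -/
def IsInducedP4 {V : Type*} (G : SimpleGraph V) (v1 v2 v3 v4 : V) : Prop :=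
  G.Adj v1 v2 ∧ G.Adj v2 v3 ∧ G.Adj v3 v4 ∧
    ¬ G.Adj v1 v3 ∧ ¬ G.Adj v1 v4 ∧ ¬ G.Adj v2 v4

/-- A cograph: no induced path on 4 vertices. -/
def IsCograph {V : Type*} (G : SimpleGraph V) : Prop :=
  ∀ a b c d : V, ¬ IsInducedP4 G a b c d

/-- `S_U`: vertices outside the path `P` whose neighborhood inside `P` is exactly `U`. -/
def Sset {V : Type*} (G : SimpleGraph V) (P U : Set V) : Set V :=
  {u | u ∉ P ∧ G.neighborSet u ∩ P = U}

/-- The graph `G₁`: two cliques `A` (of size `a+1`) and `B` (of size `b+1`) forming a complete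
graph together, a vertex `u` joined to all of `A` and a vertex `w` joined to all of `B`. -/
def graphG1 (a b : ℕ) : SimpleGraph (Unit ⊕ (Fin (a + 1) ⊕ (Fin (b + 1) ⊕ Unit))) :=
  SimpleGraph.fromRel fun x y =>
    match x, y with
    | Sum.inl _, Sum.inr (Sum.inl _) => True
    | Sum.inr (Sum.inl _), Sum.inr (Sum.inl _) => True
    | Sum.inr (Sum.inl _), Sum.inr (Sum.inr (Sum.inl _)) => True
    | Sum.inr (Sum.inr (Sum.inl _)), Sum.inr (Sum.inr (Sum.inl _)) => True
    | Sum.inr (Sum.inr (Sum.inl _)), Sum.inr (Sum.inr (Sum.inr _)) => True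
    | _, _ => False

noncomputable instance (a b : ℕ) : DecidableRel (graphG1 a b).Adj := Classical.decRel _

/-- The graph `G₂` on `m + 2` vertices: a complete graph on `m + 1` vertices together with a
pendant vertex attached to one of its vertices. -/
def graphG2 (m : ℕ) : SimpleGraph (Unit ⊕ Fin (m + 1)) :=
  SimpleGraph.fromRel fun x y =>
    match x, y with
    | Sum.inl _, Sum.inr j => j = 0
    | Sum.inr _, Sum.inr _ => True
    | _, _ => False

noncomputable instance (m : ℕ) : DecidableRel (graphG2 m).Adj := Classical.decRel _

/-- The join of a single vertex with the disjoint union of two complete graphs `K_m`. -/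
def joinTwoCliques (m : ℕ) : SimpleGraph (Unit ⊕ (Fin m ⊕ Fin m)) :=
  SimpleGraph.fromRel fun x y =>
    match x, y with
    | Sum.inl _, Sum.inr _ => True
    | Sum.inr (Sum.inl _), Sum.inr (Sum.inl _) => True
    | Sum.inr (Sum.inr _), Sum.inr (Sum.inr _) => True
    | _, _ => False

noncomputable instance (m : ℕ) : DecidableRel (joinTwoCliques m).Adj := Classical.decRel _

/-- If `M` has rank less than `k`, then every `k × k` submatrix of `M` is singular. -/
theorem det_submatrix_eq_zero_of_rank_lt {V : Type*} [Fintype V] [DecidableEq V]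
    (M : Matrix V V ℝ) {k : ℕ} (f g : Fin k → V) (hM : M.rank < k) :
    (M.submatrix f g).det = 0 := by
  by_contra h
  have hu : IsUnit (M.submatrix f g) := (Matrix.isUnit_iff_isUnit_det _).2 (isUnit_iff_ne_zero.2 h)
  have h1 : (M.submatrix f g).rank = k := by simpa using Matrix.rank_of_isUnit _ hu
  have h2 : (M.submatrix f g).rank ≤ M.rank := Matrix.rank_submatrix_le _ _ _
  omega

theorem rank_add_eigMult {V : Type*} [Fintype V] [DecidableEq V] (M : Matrix V V ℝ) (μ : ℝ) :
    (M - μ • (1 : Matrix V V ℝ)).rank + eigMult M μ = Fintype.card V := by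
  have h := LinearMap.finrank_range_add_finrank_ker (M - μ • (1 : Matrix V V ℝ)).mulVecLin
  rwa [Module.finrank_fintype_fun_eq_card] at h

/-- The determinant of a symmetric tridiagonal `4 × 4` matrix with constant diagonal. -/
theorem det_tridiagonal_four (x a b c : ℝ) :
    (!![x, a, 0, 0; a, x, b, 0; 0, b, x, c; 0, 0, c, x] : Matrix (Fin 4) (Fin 4) ℝ).det
      = x ^ 4 - (a ^ 2 + b ^ 2 + c ^ 2) * x ^ 2 + a ^ 2 * c ^ 2 := by
  simp [Matrix.det_succ_row_zero, Fin.sum_univ_succ, Fin.succAbove]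
  ring

theorem statement6 {V : Type*} [Fintype V] [DecidableEq V] (n : ℕ) (hn : 5 ≤ n)
    (G : SimpleGraph V) [DecidableRel G.Adj] (hG : memG1Family G n)
    (θ : ℝ) (hθ : eigMult (normLap G) θ = n - 3)
    (v1 v2 v3 v4 : V) (hP : IsInducedP4 G v1 v2 v3 v4) :
    (1 - θ) ^ 4 * ((G.degree v1 : ℝ) * (G.degree v2 : ℝ) * (G.degree v3 : ℝ) * (G.degree v4 : ℝ))
      - ((G.degree v1 : ℝ) * (G.degree v2 : ℝ) + (G.degree v3 : ℝ) * (G.degree v4 : ℝ)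
          + (G.degree v1 : ℝ) * (G.degree v4 : ℝ)) * (1 - θ) ^ 2 + 1 = 0 := by
  obtain ⟨-, hcard, -⟩ := hG
  obtain ⟨h12, h23, h34, h13, h14, h24⟩ := hP
  have n13 : v1 ≠ v3 := by rintro rfl; exact h14 h34
  have n14 : v1 ≠ v4 := by rintro rfl; exact h13 h34.symm
  have n24 : v2 ≠ v4 := by rintro rfl; exact h14 h12
  have hrank := rank_add_eigMult (normLap G) θ
  have hdet := det_submatrix_eq_zero_of_rank_lt (normLap G - θ • (1 : Matrix V V ℝ))
    ![v1, v2, v3, v4] ![v1, v2, v3, v4] (by omega)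
  have hsub : (normLap G - θ • (1 : Matrix V V ℝ)).submatrix ![v1, v2, v3, v4] ![v1, v2, v3, v4]
      = !![1 - θ, normLap G v1 v2, 0, 0; normLap G v1 v2, 1 - θ, normLap G v2 v3, 0;
        0, normLap G v2 v3, 1 - θ, normLap G v3 v4; 0, 0, normLap G v3 v4, 1 - θ] := by
    ext i j
    fin_cases i <;> fin_cases j <;>
      simp [normLap, h12.ne, h23.ne, h34.ne, h12.ne', h23.ne', h34.ne',
        n13, n14, n24, n13.symm, n14.symm, n24.symm, h13, h14, h24, h12, h23, h34,
        G.adj_comm v2 v1, G.adj_comm v3 v1, G.adj_comm v3 v2, G.adj_comm v4 v1,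
        G.adj_comm v4 v2, G.adj_comm v4 v3, mul_comm]
  have hsq : ∀ u v : V, G.Adj u v →
      normLap G u v ^ 2 = 1 / ((G.degree u : ℝ) * (G.degree v : ℝ)) := by
    intro u v huv
    simp only [normLap, Matrix.of_apply, huv.ne, huv, if_true, if_false]
    rw [div_pow, Real.sq_sqrt (by positivity)]
    norm_num
  have hpos : ∀ u v : V, G.Adj u v → (G.degree u : ℝ) ≠ 0 := by
    intro u v huv
    exact_mod_cast ((G.degree_pos_iff_exists_adj u).2 ⟨v, huv⟩).ne'
  have d1 := hpos _ _ h12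
  have d2 := hpos _ _ h23
  have d3 := hpos _ _ h34
  have d4 := hpos _ _ h34.symm
  rw [hsub, det_tridiagonal_four, hsq _ _ h12, hsq _ _ h23, hsq _ _ h34] at hdet
  field_simp at hdet
  linear_combination hdet
end

section
/- Let G ∈ 𝒢₁(n, n−3) with n ≥ 5 and diameter 3, and let P₄ = v₁v₂v₃v₄ be a diametrical path of G (a shortest path between two vertices at distance 3). If S_{{v₁,v₂}} ≠ ∅, then S_{{v₂,v₃,v₄}} = ∅. -/
open Matrix

/-- A minor of size exceeding the rank vanishes. -/
theorem det_submatrix_eq_zero_of_rank_lt_s7 {m n K : Type*} [Fintype m] [Fintype n]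
    [DecidableEq m] [DecidableEq n] [Field K] {k : ℕ} (A : Matrix m n K) (h : A.rank < k)
    (f : Fin k → m) (g : Fin k → n) : (A.submatrix f g).det = 0 := by
  by_contra hdet
  have hrank : (A.submatrix f g).rank = k := by
    rw [Matrix.rank_of_isUnit _ ((Matrix.isUnit_iff_isUnit_det _).2 (isUnit_iff_ne_zero.2 hdet)),
      Fintype.card_fin]
  have hfac : A.submatrix f g =
      (1 : Matrix m m K).submatrix f id * A * (1 : Matrix n n K).submatrix id g := by
    ext i j
    simp [Matrix.mul_apply, Matrix.one_apply]
  have hle : (A.submatrix f g).rank ≤ A.rank := by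
    rw [hfac]
    exact (Matrix.rank_mul_le_left _ _).trans (Matrix.rank_mul_le_right _ _)
  omega

/-- The adjacency matrix with the scaled degrees `μ * d_u` on the diagonal. -/
noncomputable def scaledDegAdj {V : Type*} [Fintype V] [DecidableEq V] (G : SimpleGraph V)
    [DecidableRel G.Adj] (μ : ℝ) : Matrix V V ℝ :=
  Matrix.of fun u v => if u = v then μ * (G.degree u : ℝ) else if G.Adj u v then 1 else 0

theorem rank_scaledDegAdj_le {V : Type*} [Fintype V] [DecidableEq V] (G : SimpleGraph V)
    [DecidableRel G.Adj] (θ : ℝ) :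
    (scaledDegAdj G (θ - 1)).rank ≤ (normLap G - θ • (1 : Matrix V V ℝ)).rank := by
  let D : Matrix V V ℝ := Matrix.diagonal fun u => Real.sqrt (G.degree u)
  have hfac : scaledDegAdj G (θ - 1) =
      (-D) * (normLap G - θ • (1 : Matrix V V ℝ)) * D := by
    ext u v
    simp only [D, Matrix.neg_mul, Matrix.neg_apply, Matrix.mul_diagonal, Matrix.diagonal_mul,
      Matrix.sub_apply, Matrix.smul_apply, Matrix.one_apply, smul_eq_mul, scaledDegAdj, normLap,
      Matrix.of_apply]
    by_cases huv : u = v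
    · subst huv
      have h := Real.mul_self_sqrt (Nat.cast_nonneg (α := ℝ) (G.degree u))
      simp only [if_true]
      linear_combination (1 - θ) * h
    · by_cases hadj : G.Adj u v
      · have hu : 0 < (G.degree u : ℝ) :=
          Nat.cast_pos.2 ((G.degree_pos_iff_exists_adj u).2 ⟨v, hadj⟩)
        have hv : 0 < (G.degree v : ℝ) :=
          Nat.cast_pos.2 ((G.degree_pos_iff_exists_adj v).2 ⟨u, hadj.symm⟩)
        have hu' := (Real.sqrt_pos.2 hu).ne'
        have hv' := (Real.sqrt_pos.2 hv).ne'
        simp only [huv, hadj, if_true, if_false, Real.sqrt_mul hu.le]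
        field_simp
        ring
      · simp [huv, hadj]
  rw [hfac]
  exact (Matrix.rank_mul_le_left _ _).trans (Matrix.rank_mul_le_right _ _)

theorem card_le_indepNum {V : Type*} [Fintype V] (G : SimpleGraph V) (s : Finset V)
    (hs : ∀ u ∈ s, ∀ v ∈ s, u ≠ v → ¬ G.Adj u v) : s.card ≤ indepNum G :=
  le_csSup ⟨Fintype.card V, by rintro k ⟨t, -, rfl⟩; exact Finset.card_le_univ t⟩ ⟨s, hs, rfl⟩

/-- If the independence number is two, the non-neighbours of a vertex form a clique. -/
theorem adj_of_not_adj_of_indepNum_eq_two {V : Type*} [Fintype V] [DecidableEq V]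
    {G : SimpleGraph V} (h : indepNum G = 2) {x y z : V} (hxy : x ≠ y) (hxz : x ≠ z)
    (hyz : y ≠ z) (nxz : ¬ G.Adj x z) (nyz : ¬ G.Adj y z) : G.Adj x y := by
  by_contra nxy
  have hle := card_le_indepNum G {x, y, z} (by
    simp only [Finset.mem_insert, Finset.mem_singleton]
    rintro u (rfl | rfl | rfl) v (rfl | rfl | rfl) <;> simp_all [G.adj_comm])
  rw [Finset.card_eq_three.2 ⟨x, y, z, hxy, hxz, hyz, rfl⟩] at hle
  omega

/-- Along a path `a b c` continuing to a vertex `d` at distance three from `a`, the degree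
increases strictly at the first step when the independence number is two. -/
theorem degree_lt_degree_of_indepNum_eq_two {V : Type*} [Fintype V] [DecidableEq V]
    {G : SimpleGraph V} [DecidableRel G.Adj] (h : indepNum G = 2) {a b c d : V}
    (hab : G.Adj a b) (hbc : G.Adj b c) (nac : ¬ G.Adj a c) (hca : c ≠ a)
    (nad : ¬ G.Adj a d) (hda : d ≠ a) (hcommon : ∀ w, G.Adj a w → ¬ G.Adj w d) :
    G.degree a < G.degree b := by
  have hsub : insert c (insert a ((G.neighborFinset a).erase b)) ⊆ G.neighborFinset b := by
    intro w hw
    simp only [Finset.mem_insert, Finset.mem_erase, SimpleGraph.mem_neighborFinset] at hw ⊢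
    rcases hw with rfl | rfl | ⟨hwb, haw⟩
    · exact hbc
    · exact hab.symm
    · exact adj_of_not_adj_of_indepNum_eq_two h hwb.symm (by rintro rfl; exact nad hab)
        (by rintro rfl; exact nad haw) (hcommon b hab) (hcommon w haw)
  have hle := Finset.card_le_card hsub
  rw [Finset.card_insert_of_notMem (by simp [nac, hca]),
    Finset.card_insert_of_notMem (by simp),
    Finset.card_erase_of_mem (by simpa using hab)] at hle
  simp only [SimpleGraph.card_neighborFinset_eq_degree] at hle
  omega

/-- If the adjacency matrix with diagonal `μ * d_u` has rank at most three, its minors on the rows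
`a, b, c, x` and columns `b, c, d, a` vanish, where `a b c d` is an induced path. -/
theorem scaledDegAdj_minor {V : Type*} [Fintype V] [DecidableEq V]
    {G : SimpleGraph V} [DecidableRel G.Adj] {μ : ℝ} (h : (scaledDegAdj G μ).rank < 4)
    {a b c d : V} (hP : IsInducedP4 G a b c d) (hac : a ≠ c) (had : a ≠ d) (hbd : b ≠ d)
    (x : V) :
    let M := scaledDegAdj G μ
    let γ := M x d
    let β := M x c - M c c * γ
    M x a = (M x b - M b b * β - γ) * M a a + β := by
  obtain ⟨hab, hbc, hcd, nac, nad, nbd⟩ := hP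
  have hdet := det_submatrix_eq_zero_of_rank_lt_s7 _ h ![a, b, c, x] ![b, c, d, a]
  have e (u v : V) (huv : G.Adj u v) : scaledDegAdj G μ u v = 1 := by
    simp [scaledDegAdj, huv, huv.ne]
  have z (u v : V) (hne : u ≠ v) (huv : ¬ G.Adj u v) : scaledDegAdj G μ u v = 0 := by
    simp [scaledDegAdj, huv, hne]
  rw [Matrix.det_succ_row_zero, Fin.sum_univ_four] at hdet
  simp only [Matrix.det_fin_three, Matrix.submatrix_apply] at hdet
  simp [Fin.succAbove, e a b hab, e b c hbc,
    e c d hcd, e b a hab.symm, e c b hbc.symm, z a c hac nac, z a d had nad, z b d hbd nbd,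
    z c a hac.symm (fun h => nac h.symm)] at hdet
  intro M γ β
  simp only [β, γ, M]
  linear_combination hdet

theorem statement7 {V : Type*} [Fintype V] [DecidableEq V] (n : ℕ) (hn : 5 ≤ n)
    (G : SimpleGraph V) [DecidableRel G.Adj] (hG : memG1Family G n) (hdiam : G.diam = 3)
    (v1 v2 v3 v4 : V) (h12 : G.Adj v1 v2) (h23 : G.Adj v2 v3) (h34 : G.Adj v3 v4)
    (hdist : G.dist v1 v4 = 3) :
    (Sset G {v1, v2, v3, v4} {v1, v2}).Nonempty →
      Sset G {v1, v2, v3, v4} {v2, v3, v4} = ∅ := by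
  rintro ⟨s, hsP, hs⟩
  by_contra hne
  obtain ⟨t, htP, ht⟩ := Set.nonempty_iff_ne_empty.2 hne
  obtain ⟨-, hcard, ⟨θ, hθ⟩, -, hind⟩ := hG
  have hsN (v : V) (hv : v ∈ ({v1, v2, v3, v4} : Set V)) :
      G.Adj s v ↔ v ∈ ({v1, v2} : Set V) := by
    rw [← hs]; simp [hv]
  have htN (v : V) (hv : v ∈ ({v1, v2, v3, v4} : Set V)) :
      G.Adj t v ↔ v ∈ ({v2, v3, v4} : Set V) := by
    rw [← ht]; simp [hv]
  have h14 : v1 ≠ v4 := by rintro rfl; simp at hdist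
  have n14 : ¬ G.Adj v1 v4 := fun h => by
    rw [SimpleGraph.dist_eq_one_iff_adj.2 h] at hdist; omega
  have hcommon (w : V) (h1 : G.Adj v1 w) : ¬ G.Adj w v4 := fun h2 => by
    have h := SimpleGraph.dist_le (.cons h1 (.cons h2 .nil))
    simp only [SimpleGraph.Walk.length_cons, SimpleGraph.Walk.length_nil] at h
    omega
  have n13 : ¬ G.Adj v1 v3 := fun h => hcommon v3 h h34
  have n24 : ¬ G.Adj v2 v4 := hcommon v2 h12
  have h13 : v1 ≠ v3 := by rintro rfl; exact n14 h34
  have h24 : v2 ≠ v4 := by rintro rfl; exact n14 h12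
  have hd12 : G.degree v1 < G.degree v2 :=
    degree_lt_degree_of_indepNum_eq_two hind h12 h23 n13 h13.symm n14 h14.symm hcommon
  have hd43 : G.degree v4 < G.degree v3 :=
    degree_lt_degree_of_indepNum_eq_two hind h34.symm h23.symm (fun h => n24 h.symm) h24
      (fun h => n14 h.symm) h14 fun w hw hw' => hcommon w hw'.symm hw.symm
  have hrank : (scaledDegAdj G (θ - 1)).rank < 4 := by
    have h1 := rank_scaledDegAdj_le G θ
    have h2 := rank_add_eigMult (normLap G) θ
    omega
  have minor := scaledDegAdj_minor hrank ⟨h12, h23, h34, n13, n14, n24⟩ h13 h14 h24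
  have ms := minor s
  have mt := minor t
  have m4 := minor v4
  simp only [Set.mem_insert_iff, Set.mem_singleton_iff, not_or] at hsP htP
  have hs1 : G.Adj s v1 := (hsN v1 (by simp)).2 (by simp)
  have hs2 : G.Adj s v2 := (hsN v2 (by simp)).2 (by simp)
  have hs3 : ¬ G.Adj s v3 := by rw [hsN v3 (by simp)]; simp [h13.symm, h23.ne.symm]
  have hs4 : ¬ G.Adj s v4 := hcommon s hs1.symm
  have ht2 : G.Adj t v2 := (htN v2 (by simp)).2 (by simp)
  have ht3 : G.Adj t v3 := (htN v3 (by simp)).2 (by simp)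
  have ht4 : G.Adj t v4 := (htN v4 (by simp)).2 (by simp)
  have ht1 : ¬ G.Adj t v1 := fun h => hcommon t h.symm ht4
  have n41 : ¬ G.Adj v4 v1 := fun h => n14 h.symm
  have n42 : ¬ G.Adj v4 v2 := fun h => n24 h.symm
  simp [scaledDegAdj, hs1, hs2, hs3, hs4, hsP] at ms
  simp [scaledDegAdj, ht1, ht2, ht3, ht4, htP] at mt
  simp [scaledDegAdj, h34.symm, n41, n42, h14.symm, h24.symm, h34.ne.symm] at m4
  have hd12' : (G.degree v1 : ℝ) < G.degree v2 := Nat.cast_lt.2 hd12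
  have hd43' : (G.degree v4 : ℝ) < G.degree v3 := Nat.cast_lt.2 hd43
  have hd1 : (0 : ℝ) ≤ G.degree v1 := Nat.cast_nonneg _
  have hd4 : (0 : ℝ) < G.degree v4 :=
    Nat.cast_pos.2 ((G.degree_pos_iff_exists_adj v4).2 ⟨v3, h34.symm⟩)
  have hμ : 0 < θ - 1 := by
    by_contra hle
    nlinarith
  have ha12 := mul_lt_mul_of_pos_left hd12' hμ
  have ha43 := mul_lt_mul_of_pos_left hd43' hμ
  have ha4 := mul_pos hμ hd4
  generalize (θ - 1) * (G.degree v1 : ℝ) = a1 at *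
  generalize (θ - 1) * (G.degree v2 : ℝ) = a2 at *
  generalize (θ - 1) * (G.degree v3 : ℝ) = a3 at *
  generalize (θ - 1) * (G.degree v4 : ℝ) = a4 at *
  subst ms
  have ha3 : a3 = 1 := by
    have h : (1 - a2) * (1 - a3) = 0 := by linear_combination -mt
    rcases mul_eq_zero.1 h with h | h <;> linarith
  subst ha3
  nlinarith [mul_pos (sub_pos.2 ha12) (sub_pos.2 ha43)]
end

section
/- Let G be a connected simple graph with independence number ν(G) = 2 and diameter 3, and let v₁v₂v₃v₄ be a shortest path between two vertices v₁, v₄ at distance 3. Then every vertex u ∈ V(G) \ {v₁, v₂, v₃, v₄} satisfies N_G(u) ∩ {v₁, v₂, v₃, v₄} ∈ { {v₁,v₂}, {v₃,v₄}, {v₁,v₂,v₃}, {v₂,v₃,v₄} }. -/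
open Matrix

theorem adj_or_adj_of_indepNum_le_two {V : Type*} [Fintype V] {G : SimpleGraph V}
    (hnu : indepNum G ≤ 2) {a b u : V} (hab : a ≠ b) (hua : u ≠ a) (hub : u ≠ b)
    (hnab : ¬ G.Adj a b) : G.Adj u a ∨ G.Adj u b := by
  classical
  by_contra! h
  have hcard : ({a, b, u} : Finset V).card = 3 :=
    Finset.card_eq_three.mpr ⟨a, b, u, hab, hua.symm, hub.symm, rfl⟩
  have := card_le_indepNum G {a, b, u} (by
    simp only [Finset.mem_insert, Finset.mem_singleton]
    grind [G.adj_comm])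
  omega

theorem not_adj_of_two_lt_dist {V : Type*} {G : SimpleGraph V} {a b c : V}
    (h : 2 < G.dist a b) (hac : G.Adj a c) : ¬ G.Adj c b := fun hcb =>
  h.not_ge (G.dist_le (.cons hac (.cons hcb .nil)))

theorem statement9 {V : Type*} [Fintype V] (G : SimpleGraph V)
    (hconn : G.Connected) (hnu : indepNum G = 2) (hdiam : G.diam = 3)
    (v1 v2 v3 v4 : V) (h12 : G.Adj v1 v2) (h23 : G.Adj v2 v3) (h34 : G.Adj v3 v4)
    (hdist : G.dist v1 v4 = 3) :
    ∀ u : V, u ∉ ({v1, v2, v3, v4} : Set V) →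
      G.neighborSet u ∩ {v1, v2, v3, v4} = {v1, v2} ∨
      G.neighborSet u ∩ {v1, v2, v3, v4} = {v3, v4} ∨
      G.neighborSet u ∩ {v1, v2, v3, v4} = {v1, v2, v3} ∨
      G.neighborSet u ∩ {v1, v2, v3, v4} = {v2, v3, v4} := by
  intro u hu
  simp only [Set.mem_insert_iff, Set.mem_singleton_iff, not_or] at hu
  obtain ⟨hu1, hu2, hu3, hu4⟩ := hu
  have hdist' : 2 < G.dist v1 v4 := by omega
  have h24 : ¬ G.Adj v2 v4 := not_adj_of_two_lt_dist hdist' h12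
  have h13 : ¬ G.Adj v1 v3 := fun h => not_adj_of_two_lt_dist hdist' h h34
  have h14 : ¬ G.Adj v1 v4 := fun h => by
    rw [SimpleGraph.dist_eq_one_iff_adj.mpr h] at hdist
    omega
  have hne13 : v1 ≠ v3 := fun h => h14 (h ▸ h34)
  have hne24 : v2 ≠ v4 := fun h => h14 (h ▸ h12)
  have hne14 : v1 ≠ v4 := fun h => by simp [h] at hdist
  have hu14 : ¬ (G.Adj u v1 ∧ G.Adj u v4) := fun h =>
    not_adj_of_two_lt_dist hdist' h.1.symm h.2
  have a14 := adj_or_adj_of_indepNum_le_two hnu.le hne14 hu1 hu4 h14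
  have a13 := adj_or_adj_of_indepNum_le_two hnu.le hne13 hu1 hu3 h13
  have a24 := adj_or_adj_of_indepNum_le_two hnu.le hne24 hu2 hu4 h24
  simp only [Set.ext_iff, Set.mem_inter_iff, SimpleGraph.mem_neighborSet, Set.mem_insert_iff,
    Set.mem_singleton_iff]
  grind
end

section
/- Let G be a cograph with diameter 2 belonging to 𝒢₁(n, n−3) with n ≥ 5. Then G contains no induced subgraph isomorphic to the 5-vertex graph H₂, whose edge set on vertices {v₁, v₂, v₃, v₄, v₅} is {v₁v₂, v₂v₃, v₁v₄, v₂v₄, v₁v₅, v₂v₅, v₃v₅, v₄v₅} (so v₁v₃ and v₃v₄ are non-edges). -/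
open Matrix

/-- The matrix `A + t D`, where `A` is the adjacency matrix and `D` the degree matrix. -/
noncomputable def adjPencil {V : Type*} [Fintype V] [DecidableEq V] (G : SimpleGraph V)
    [DecidableRel G.Adj] (t : ℝ) : Matrix V V ℝ :=
  Matrix.of fun u v => if u = v then t * G.degree u else if G.Adj u v then 1 else 0

/-- The vertices `a, a', r, p, q` induce `K₂ ∨ (K₂ ∪ K₁)`, where `p, q` span the first `K₂`,
`a, a'` the second one and `r` is the `K₁`. -/
structure InducesH2 {V : Type*} (G : SimpleGraph V) (a a' r p q : V) : Prop where
  aa' : G.Adj a a'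
  pq : G.Adj p q
  ap : G.Adj a p
  aq : G.Adj a q
  a'p : G.Adj a' p
  a'q : G.Adj a' q
  rp : G.Adj r p
  rq : G.Adj r q
  a_ne_r : a ≠ r
  a'_ne_r : a' ≠ r
  not_ar : ¬ G.Adj a r
  not_a'r : ¬ G.Adj a' r

section

variable {V : Type*}

lemma InducesH2.swap {G : SimpleGraph V} {a a' r p q : V} (h : InducesH2 G a a' r p q) :
    InducesH2 G a a' r q p :=
  ⟨h.aa', h.pq.symm, h.aq, h.ap, h.a'q, h.a'p, h.rq, h.rp, h.a_ne_r, h.a'_ne_r, h.not_ar,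
    h.not_a'r⟩

lemma InducesH2.swap_twins {G : SimpleGraph V} {a a' r p q : V} (h : InducesH2 G a a' r p q) :
    InducesH2 G a' a r p q :=
  ⟨h.aa'.symm, h.pq, h.a'p, h.a'q, h.ap, h.aq, h.rp, h.rq, h.a'_ne_r, h.a_ne_r, h.not_a'r,
    h.not_ar⟩

section Combinatorial

variable {G : SimpleGraph V} (hco : IsCograph G)
  (hind : ∀ u v w : V, u ≠ v → u ≠ w → v ≠ w → G.Adj u v ∨ G.Adj u w ∨ G.Adj v w)
include hco hind

/-- In a cograph without independent triples, two vertices `a, r` that are not adjacent are both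
adjacent to every vertex missed by a common neighbour. -/
lemma adj_of_not_adj_common_nbr {a r p v : V} (hne : a ≠ r) (har : ¬ G.Adj a r)
    (hap : G.Adj a p) (hrp : G.Adj r p) (hv : ¬ G.Adj v p) :
    G.Adj v a ∧ G.Adj v r := by
  have hva : v ≠ a := fun h => hv (h ▸ hap)
  have hvr : v ≠ r := fun h => hv (h ▸ hrp)
  have h3 := hind v a r hva hvr hne
  have c1 := hco v a p r
  have c2 := hco v r p a
  simp only [IsInducedP4] at c1 c2
  grind [G.adj_comm]

lemma InducesH2.adj_twin {a a' r p q v : V} (h : InducesH2 G a a' r p q)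
    (hv : G.Adj a v) (hva' : v ≠ a') : G.Adj a' v := by
  by_contra hn
  have hvr : v ≠ r := fun e => h.not_ar (e ▸ hv)
  have h3 := hind a' v r hva'.symm h.a'_ne_r hvr
  have c := hco a' a v r
  have := h.aa'
  have := h.not_ar
  have := h.not_a'r
  simp only [IsInducedP4] at c
  grind [G.adj_comm]

lemma InducesH2.degree_eq [Fintype V] [DecidableEq V] [DecidableRel G.Adj] {a a' r p q : V}
    (h : InducesH2 G a a' r p q) : G.degree a = G.degree a' := by
  have key : ∀ {b b' : V}, InducesH2 G b b' r p q →
      insert b (G.neighborFinset b) ⊆ insert b' (G.neighborFinset b') := by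
    intro b b' hb v hv
    simp only [Finset.mem_insert, SimpleGraph.mem_neighborFinset] at hv ⊢
    rcases hv with rfl | hv
    · exact Or.inr hb.aa'.symm
    · by_cases e : v = b'
      · exact Or.inl e
      · exact Or.inr (hb.adj_twin hco hind hv e)
  have := congrArg Finset.card ((key h).antisymm (key h.swap_twins))
  simpa using this

end Combinatorial

lemma det_fin_four {R : Type*} [CommRing R] (M : Matrix (Fin 4) (Fin 4) R) :
    M.det =
    M 0 0 * (M 1 1 * (M 2 2 * M 3 3 - M 2 3 * M 3 2) - M 1 2 * (M 2 1 * M 3 3 - M 2 3 * M 3 1)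
        + M 1 3 * (M 2 1 * M 3 2 - M 2 2 * M 3 1))
      - M 0 1 * (M 1 0 * (M 2 2 * M 3 3 - M 2 3 * M 3 2) - M 1 2 * (M 2 0 * M 3 3 - M 2 3 * M 3 0)
        + M 1 3 * (M 2 0 * M 3 2 - M 2 2 * M 3 0))
      + M 0 2 * (M 1 0 * (M 2 1 * M 3 3 - M 2 3 * M 3 1) - M 1 1 * (M 2 0 * M 3 3 - M 2 3 * M 3 0)
        + M 1 3 * (M 2 0 * M 3 1 - M 2 1 * M 3 0))
      - M 0 3 * (M 1 0 * (M 2 1 * M 3 2 - M 2 2 * M 3 1) - M 1 1 * (M 2 0 * M 3 2 - M 2 2 * M 3 0)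
        + M 1 2 * (M 2 0 * M 3 1 - M 2 1 * M 3 0)) := by
  rw [Matrix.det_succ_row_zero, Fin.sum_univ_four]
  simp only [Matrix.det_fin_three, Matrix.submatrix_apply]
  simp [Fin.succAbove]
  ring_nf

variable [Fintype V] [DecidableEq V]

omit [DecidableEq V] in
lemma det_submatrix_eq_zero_of_rank_lt_s13 {k : ℕ} {N : Matrix V V ℝ} (hN : N.rank < k)
    (r c : Fin k → V) : (N.submatrix r c).det = 0 := by
  by_contra hdet
  have h1 := Matrix.rank_of_isUnit (N.submatrix r c)
    ((Matrix.isUnit_iff_isUnit_det _).2 (isUnit_iff_ne_zero.2 hdet))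
  rw [Fintype.card_fin] at h1
  have h2 := Matrix.rank_submatrix_le N r c
  omega

lemma minor_four_eq_zero {N : Matrix V V ℝ} (hN : N.rank ≤ 3) (a b c d a' b' c' d' : V) :
    N a a' * (N b b' * (N c c' * N d d' - N c d' * N d c')
        - N b c' * (N c b' * N d d' - N c d' * N d b')
        + N b d' * (N c b' * N d c' - N c c' * N d b'))
      - N a b' * (N b a' * (N c c' * N d d' - N c d' * N d c')
        - N b c' * (N c a' * N d d' - N c d' * N d a')
        + N b d' * (N c a' * N d c' - N c c' * N d a'))
      + N a c' * (N b a' * (N c b' * N d d' - N c d' * N d b')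
        - N b b' * (N c a' * N d d' - N c d' * N d a')
        + N b d' * (N c a' * N d b' - N c b' * N d a'))
      - N a d' * (N b a' * (N c b' * N d c' - N c c' * N d b')
        - N b b' * (N c a' * N d c' - N c c' * N d a')
        + N b c' * (N c a' * N d b' - N c b' * N d a')) = 0 := by
  have h := det_submatrix_eq_zero_of_rank_lt_s13 (Nat.lt_succ_of_le hN) ![a, b, c, d] ![a', b', c', d']
  rw [det_fin_four] at h
  exact h

variable {G : SimpleGraph V} [DecidableRel G.Adj] {t : ℝ}

lemma adjPencil_self (u : V) : adjPencil G t u u = t * G.degree u := by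
  simp [adjPencil]

lemma adjPencil_of_adj {u v : V} (h : G.Adj u v) : adjPencil G t u v = 1 := by
  simp [adjPencil, h, h.ne]

lemma adjPencil_of_not_adj {u v : V} (hne : u ≠ v) (h : ¬ G.Adj u v) :
    adjPencil G t u v = 0 := by
  simp [adjPencil, h, hne]

lemma adjPencil_comm (u v : V) : adjPencil G t u v = adjPencil G t v u := by
  by_cases h : u = v
  · rw [h]
  · simp [adjPencil, h, Ne.symm h, G.adj_comm]

lemma adjPencil_eq_mul_mul (θ : ℝ) :
    adjPencil G (θ - 1) =
      Matrix.diagonal (fun u => -Real.sqrt (G.degree u)) * (normLap G - θ • (1 : Matrix V V ℝ)) *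
        Matrix.diagonal (fun u => Real.sqrt (G.degree u)) := by
  ext u v
  rw [Matrix.mul_diagonal, Matrix.diagonal_mul]
  by_cases h : u = v
  · subst h
    have := Real.mul_self_sqrt (Nat.cast_nonneg (α := ℝ) (G.degree u))
    simp [adjPencil, normLap]
    linear_combination (1 - θ) * this
  · by_cases ha : G.Adj u v
    · have hu : 0 < (G.degree u : ℝ) := by
        exact_mod_cast (G.degree_pos_iff_exists_adj u).2 ⟨v, ha⟩
      have hv : 0 < (G.degree v : ℝ) := by
        exact_mod_cast (G.degree_pos_iff_exists_adj v).2 ⟨u, ha.symm⟩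
      have hu' := Real.sqrt_pos.2 hu
      have hv' := Real.sqrt_pos.2 hv
      simp [adjPencil, normLap, h, ha]
      field_simp
    · simp [adjPencil, normLap, h, ha]

lemma rank_adjPencil_add_eigMult_le (θ : ℝ) :
    (adjPencil G (θ - 1)).rank + eigMult (normLap G) θ ≤ Fintype.card V := by
  have h1 : (adjPencil G (θ - 1)).rank ≤ (normLap G - θ • (1 : Matrix V V ℝ)).rank := by
    rw [adjPencil_eq_mul_mul]
    exact (Matrix.rank_mul_le_left _ _).trans (Matrix.rank_mul_le_right _ _)
  have h2 := LinearMap.finrank_range_add_finrank_ker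
    (normLap G - θ • (1 : Matrix V V ℝ)).mulVecLin
  rw [Module.finrank_fintype_fun_eq_card] at h2
  rw [← Matrix.rank] at h2
  unfold eigMult
  omega

lemma degree_eq_of_universal {p : V} (h : ∀ v, v ≠ p → G.Adj v p) :
    (G.degree p : ℝ) = Fintype.card V - 1 := by
  have : G.neighborFinset p = Finset.univ.erase p := by
    ext v
    simp only [SimpleGraph.mem_neighborFinset, Finset.mem_erase, Finset.mem_univ, and_true]
    exact ⟨fun e => e.ne', fun e => (h v e).symm⟩
  have h1 : G.degree p = Fintype.card V - 1 := by
    rw [← G.card_neighborFinset_eq_degree, this, Finset.card_erase_of_mem (Finset.mem_univ _),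
      Finset.card_univ]
  have : 0 < Fintype.card V := Fintype.card_pos_iff.2 ⟨p⟩
  rw [h1, Nat.cast_sub this, Nat.cast_one]

omit [DecidableEq V] in
lemma degree_le_card_sub_one (v : V) : (G.degree v : ℝ) ≤ Fintype.card V - 1 := by
  have := G.degree_lt_card_verts v
  have : (G.degree v : ℝ) + 1 ≤ Fintype.card V := by exact_mod_cast this
  linarith

omit [DecidableEq V] in
lemma one_le_degree {u v : V} (h : G.Adj u v) : (1 : ℝ) ≤ G.degree u := by
  exact_mod_cast Nat.succ_le_of_lt ((G.degree_pos_iff_exists_adj u).2 ⟨v, h⟩)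

/-- If the closed neighbourhoods of `a` and `r` cover the graph and there are two common
neighbours, the degrees of `a` and `r` sum to at least the order. -/
lemma card_le_degree_add_degree {a r p q : V} (hpq : p ≠ q)
    (hap : G.Adj a p) (haq : G.Adj a q) (hrp : G.Adj r p) (hrq : G.Adj r q)
    (hcov : ∀ v, v ≠ a → v ≠ r → G.Adj a v ∨ G.Adj r v) :
    Fintype.card V ≤ G.degree a + G.degree r := by
  have h := Finset.card_union_add_card_inter (insert a (G.neighborFinset a))
    (insert r (G.neighborFinset r))
  have hu : insert a (G.neighborFinset a) ∪ insert r (G.neighborFinset r) = Finset.univ := by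
    ext v
    have := hcov v
    simp only [Finset.mem_union, Finset.mem_insert, SimpleGraph.mem_neighborFinset,
      Finset.mem_univ, iff_true]
    tauto
  have hi : ({p, q} : Finset V) ⊆
      insert a (G.neighborFinset a) ∩ insert r (G.neighborFinset r) := by
    intro v hv
    simp only [Finset.mem_insert, Finset.mem_singleton] at hv
    rcases hv with rfl | rfl <;> simp [*]
  have h2 := Finset.card_le_card hi
  rw [Finset.card_pair hpq] at h2
  rw [hu, Finset.card_univ] at h
  simp at h
  omega

section Rank

variable (hN : (adjPencil G t).rank ≤ 3) (hco : IsCograph G)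
  (hind : ∀ u v w : V, u ≠ v → u ≠ w → v ≠ w → G.Adj u v ∨ G.Adj u w ∨ G.Adj v w)
include hN hco hind

lemma InducesH2.mul_degree_eq_one {a a' r p q : V} (h : InducesH2 G a a' r p q) :
    t * G.degree a = 1 := by
  by_contra hne
  have e0 : t * (G.degree a : ℝ) - 1 ≠ 0 := sub_ne_zero.2 hne
  have hdr := one_le_degree h.rp
  have hda := one_le_degree h.ap
  have m1 := minor_four_eq_zero hN a a' r p a a' r q
  have m2 := minor_four_eq_zero hN a a' r p a a' r p
  simp only [adjPencil_self, adjPencil_of_adj h.aa', adjPencil_of_adj h.aa'.symm,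
    adjPencil_of_adj h.pq, adjPencil_of_adj h.ap, adjPencil_of_adj h.aq, adjPencil_of_adj h.a'p,
    adjPencil_of_adj h.a'q, adjPencil_of_adj h.rp, adjPencil_of_adj h.rq,
    adjPencil_of_adj h.ap.symm, adjPencil_of_adj h.a'p.symm, adjPencil_of_adj h.rp.symm,
    adjPencil_of_not_adj h.a_ne_r h.not_ar, adjPencil_of_not_adj h.a'_ne_r h.not_a'r,
    adjPencil_comm r a, adjPencil_comm r a', ← h.degree_eq hco hind] at m1 m2
  set d : ℝ := (G.degree a : ℝ)
  set s : ℝ := (G.degree r : ℝ)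
  have k1 : (t * d + 1) * (t * s) - (t * d + 1) - 2 * (t * s) = 0 :=
    mul_left_cancel₀ e0 (by linear_combination m1)
  have k2 : (t * d + 1) * (t * s) * (t * G.degree p) - (t * d + 1) - 2 * (t * s) = 0 :=
    mul_left_cancel₀ e0 (by linear_combination m2)
  have hnz : (t * d + 1) * (t * s) ≠ 0 := by
    intro h0
    have h2 : (t * s) * (t * s) = 0 := by
      linear_combination -(1 / 2) * h0 - (t * s) / 2 * (k1 - h0)
    have h3 : t = 0 := by
      have := mul_self_eq_zero.1 h2
      rcases mul_eq_zero.1 this with h | h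
      · exact h
      · linarith
    rw [h3] at k1
    linarith
  have huniv : ∀ v, v ≠ p → G.Adj v p := by
    intro v hvp
    by_contra hv
    obtain ⟨va, vr⟩ := adj_of_not_adj_common_nbr hco hind h.a_ne_r h.not_ar h.ap h.rp hv
    obtain ⟨va', -⟩ := adj_of_not_adj_common_nbr hco hind h.a'_ne_r h.not_a'r h.a'p h.rp hv
    have m3 := minor_four_eq_zero hN a a' r p a a' r v
    simp only [adjPencil_self, adjPencil_of_adj h.aa', adjPencil_of_adj h.aa'.symm,
      adjPencil_of_adj va.symm, adjPencil_of_adj va'.symm, adjPencil_of_adj vr.symm,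
      adjPencil_of_adj h.ap.symm, adjPencil_of_adj h.a'p.symm, adjPencil_of_adj h.rp.symm,
      adjPencil_of_not_adj h.a_ne_r h.not_ar, adjPencil_of_not_adj h.a'_ne_r h.not_a'r,
      adjPencil_comm r a, adjPencil_comm r a', ← h.degree_eq hco hind,
      adjPencil_comm p v, adjPencil_of_not_adj hvp hv] at m3
    have k3 : - (t * d + 1) - 2 * (t * s) = 0 :=
      mul_left_cancel₀ e0 (by linear_combination m3)
    exact hnz (by linear_combination k1 - k3)
  have hp := degree_eq_of_universal huniv
  have htp : t * (G.degree p : ℝ) = 1 := mul_left_cancel₀ hnz (by linear_combination k2 - k1)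
  have hdm : d ≤ G.degree p := hp ▸ degree_le_card_sub_one a
  have hsm : s ≤ G.degree p := hp ▸ degree_le_card_sub_one r
  set m : ℝ := (G.degree p : ℝ)
  have k4 : (d + m) * s = m * (d + m) + 2 * m * s := by
    linear_combination m ^ 2 * k1 + (-(t * m + 1) * d * s + m * d - m * s + 2 * m * s) * htp
  nlinarith [mul_nonneg (by linarith : (0 : ℝ) ≤ d + m) (by linarith : (0 : ℝ) ≤ m - s),
    mul_pos (by linarith : 0 < m) (by linarith : 0 < s)]

lemma InducesH2.universal {a a' r p q : V} (h : InducesH2 G a a' r p q) :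
    ∀ v, v ≠ q → G.Adj v q := by
  intro v hvq
  by_contra hv
  have ht := h.mul_degree_eq_one hN hco hind
  obtain ⟨va, vr⟩ := adj_of_not_adj_common_nbr hco hind h.a_ne_r h.not_ar h.aq h.rq hv
  have hda := one_le_degree h.ap
  have htpos : 0 < t := by
    by_contra hc
    nlinarith
  have hy : 0 < t * (G.degree r : ℝ) := mul_pos htpos (by linarith [one_le_degree h.rp])
  have hw : 0 < t * (G.degree q : ℝ) := mul_pos htpos (by linarith [one_le_degree h.rq.symm])
  have hu : 0 < t * (G.degree v : ℝ) := mul_pos htpos (by linarith [one_le_degree va])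
  have e1 := adjPencil_of_not_adj (t := t) h.a_ne_r h.not_ar
  have e2 := adjPencil_of_not_adj (t := t) hvq hv
  by_cases hvp : G.Adj v p
  · have m1 := minor_four_eq_zero hN a p q r a p v r
    have m2 := minor_four_eq_zero hN a p q v a p q v
    have m3 := minor_four_eq_zero hN a q v r a q v r
    simp only [adjPencil_self, ht, adjPencil_of_adj h.pq, adjPencil_of_adj h.pq.symm,
      adjPencil_of_adj h.ap, adjPencil_of_adj h.ap.symm, adjPencil_of_adj h.aq,
      adjPencil_of_adj h.aq.symm, adjPencil_of_adj h.rp, adjPencil_of_adj h.rp.symm,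
      adjPencil_of_adj h.rq, adjPencil_of_adj h.rq.symm, adjPencil_of_adj va,
      adjPencil_of_adj va.symm, adjPencil_of_adj vr, adjPencil_of_adj vr.symm,
      adjPencil_of_adj hvp, adjPencil_of_adj hvp.symm, adjPencil_comm r a,
      adjPencil_comm q v, e1, e2] at m1 m2 m3
    set y := t * (G.degree r : ℝ)
    set z := t * (G.degree p : ℝ) - 1 with hz
    set w := t * (G.degree q : ℝ)
    set u := t * (G.degree v : ℝ)
    have hz0 : z ≠ 0 := by
      intro h0
      have hz1 : t * (G.degree p : ℝ) = 1 := by linarith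
      rw [hz1] at m1
      linarith
    have k2 : (w - 1) * (u - 1) = 1 := mul_left_cancel₀ hz0 (by rw [hz]; linear_combination m2)
    have k3 : w + u = 0 := by linear_combination -m3 + y * k2
    linarith
  · have hvp' : v ≠ p := fun e => hv (e ▸ h.pq)
    have e3 := adjPencil_of_not_adj (t := t) hvp' hvp
    have m1 := minor_four_eq_zero hN a p q r a p r v
    have m2 := minor_four_eq_zero hN a r p v a r p v
    simp only [adjPencil_self, ht, adjPencil_of_adj h.pq.symm,
      adjPencil_of_adj h.ap, adjPencil_of_adj h.ap.symm, adjPencil_of_adj h.aq.symm,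
      adjPencil_of_adj h.rp, adjPencil_of_adj h.rp.symm,
      adjPencil_of_adj h.rq.symm, adjPencil_of_adj va,
      adjPencil_of_adj va.symm, adjPencil_of_adj vr, adjPencil_of_adj vr.symm,
      adjPencil_comm r a, adjPencil_comm q v, adjPencil_comm p v, e1, e2, e3] at m1 m2
    have k1 : t * (G.degree p : ℝ) = 1 :=
      mul_left_cancel₀ (by linarith : t * (G.degree r : ℝ) + 1 ≠ 0) (by linear_combination m1)
    rw [k1] at m2
    linarith

lemma not_inducesH2 {a a' r p q : V} (h : InducesH2 G a a' r p q) : False := by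
  have ht := h.mul_degree_eq_one hN hco hind
  have hq := h.universal hN hco hind
  have hp := h.swap.universal hN hco hind
  have dp := degree_eq_of_universal hp
  have dq := degree_eq_of_universal hq
  have hcov : ∀ v, v ≠ a → v ≠ r → G.Adj a v ∨ G.Adj r v := fun v hva hvr => by
    have := hind a r v h.a_ne_r hva.symm hvr.symm
    have := h.not_ar
    tauto
  have hcard := card_le_degree_add_degree h.pq.ne h.ap h.aq h.rp h.rq hcov
  have hcard' : (Fintype.card V : ℝ) ≤ G.degree a + G.degree r := by exact_mod_cast hcard
  have hr := degree_le_card_sub_one (G := G) r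
  have hda := one_le_degree h.ap
  have hdr := one_le_degree h.rp
  have m := minor_four_eq_zero hN a r p q a r p q
  simp only [adjPencil_self, ht, adjPencil_of_adj h.pq, adjPencil_of_adj h.pq.symm,
    adjPencil_of_adj h.ap, adjPencil_of_adj h.ap.symm, adjPencil_of_adj h.aq,
    adjPencil_of_adj h.aq.symm, adjPencil_of_adj h.rp, adjPencil_of_adj h.rp.symm,
    adjPencil_of_adj h.rq, adjPencil_of_adj h.rq.symm, adjPencil_comm r a,
    adjPencil_of_not_adj h.a_ne_r h.not_ar, dp, dq] at m
  have hda' : (G.degree a : ℝ) + 1 ≤ Fintype.card V - 1 := by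
    have hss : insert a (insert r (G.neighborFinset a)) ⊆ Finset.univ := Finset.subset_univ _
    have := Finset.card_le_card hss
    rw [Finset.card_insert_of_notMem (by simp [h.a_ne_r]),
      Finset.card_insert_of_notMem (by simpa using h.not_ar), Finset.card_univ,
      G.card_neighborFinset_eq_degree] at this
    have : (G.degree a : ℝ) + 1 + 1 ≤ Fintype.card V := by exact_mod_cast this
    linarith
  set d : ℝ := (G.degree a : ℝ)
  set s : ℝ := (G.degree r : ℝ)
  set k : ℝ := (Fintype.card V : ℝ) - 1 with hk
  have htpos : 0 < t := by
    by_contra hc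
    nlinarith
  have hz : t * k - 1 ≠ 0 := by
    have : 0 < t * (k - d) := mul_pos htpos (by linarith)
    have h2 : t * k - 1 = t * (k - d) := by linear_combination ht
    rw [h2]
    exact this.ne'
  have k1 : t * s * (t * k - 1) = 2 := mul_left_cancel₀ hz (by linear_combination m)
  have k2 : s * (k - d) = 2 * d ^ 2 := by
    linear_combination d ^ 2 * k1 + (-(d * t + 1) * s * k + s * d) * ht
  by_cases hb : ∃ r', r' ≠ a ∧ r' ≠ r ∧ ¬ G.Adj a r'
  · obtain ⟨r', h1, h2, h3⟩ := hb
    have hp' : r' ≠ p := fun e => h3 (e ▸ h.ap)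
    have hq' : r' ≠ q := fun e => h3 (e ▸ h.aq)
    have hrr : G.Adj r r' := (hcov r' h1 h2).resolve_left h3
    have h' : InducesH2 G r r' a p q :=
      ⟨hrr, h.pq, h.rp, h.rq, hp r' hp', hq r' hq', h.ap, h.aq, h.a_ne_r.symm, h1,
        fun e => h.not_ar e.symm, fun e => h3 e.symm⟩
    have ht' := h'.mul_degree_eq_one hN hco hind
    have hds : d = s := mul_left_cancel₀ htpos.ne' (ht.trans ht'.symm)
    rw [← hds] at k2 hcard'
    have : k - d = 2 * d := mul_left_cancel₀ (by linarith : d ≠ 0) (by linear_combination k2)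
    linarith
  · push Not at hb
    have hle : (Fintype.card V : ℝ) ≤ d + 2 := by
      have hss : Finset.univ ⊆ insert a (insert r (G.neighborFinset a)) := by
        intro v _
        have := hb v
        simp only [Finset.mem_insert, SimpleGraph.mem_neighborFinset]
        tauto
      have := Finset.card_le_card hss
      rw [Finset.card_insert_of_notMem (by simp [h.a_ne_r]),
        Finset.card_insert_of_notMem (by simpa using h.not_ar), Finset.card_univ,
        G.card_neighborFinset_eq_degree] at this
      have : (Fintype.card V : ℝ) ≤ G.degree a + 1 + 1 := by exact_mod_cast this
      linarith
    have hd2 : 2 ≤ d := by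
      have hss : ({p, q} : Finset V) ⊆ G.neighborFinset a := by
        intro v hv
        simp only [Finset.mem_insert, Finset.mem_singleton] at hv
        rcases hv with rfl | rfl <;> simp [h.ap, h.aq]
      have := Finset.card_le_card hss
      rw [Finset.card_pair h.pq.ne, G.card_neighborFinset_eq_degree] at this
      simpa [d] using (Nat.cast_le (α := ℝ)).2 this
    have : k - d = 1 := by linarith
    rw [this] at k2
    nlinarith

end Rank

omit [DecidableEq V] [DecidableRel G.Adj] in
lemma adj_of_indepNum_eq_two (hG : indepNum G = 2) (u v w : V) (huv : u ≠ v) (huw : u ≠ w)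
    (hvw : v ≠ w) : G.Adj u v ∨ G.Adj u w ∨ G.Adj v w := by
  classical
  by_contra! hn
  have hbdd : BddAbove {k | ∃ s : Finset V,
      (∀ u ∈ s, ∀ v ∈ s, u ≠ v → ¬ G.Adj u v) ∧ s.card = k} := by
    refine ⟨Fintype.card V, ?_⟩
    rintro k ⟨s, -, rfl⟩
    exact Finset.card_le_univ s
  have h3 : 3 ≤ indepNum G := by
    refine le_csSup hbdd ⟨{u, v, w}, ?_, Finset.card_eq_three.2 ⟨u, v, w, huv, huw, hvw, rfl⟩⟩
    intro x hx y hy hxy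
    simp only [Finset.mem_insert, Finset.mem_singleton] at hx hy
    rcases hx with rfl | rfl | rfl <;> rcases hy with rfl | rfl | rfl <;>
      simp_all [G.adj_comm]
  omega

end

theorem statement13 {V : Type*} [Fintype V] [DecidableEq V] (n : ℕ) (hn : 5 ≤ n)
    (G : SimpleGraph V) [DecidableRel G.Adj]
    (hG : memG1Family G n) (hco : IsCograph G) (hdiam : G.diam = 2) :
    ¬ ∃ w1 w2 w3 w4 w5 : V,
      w1 ≠ w2 ∧ w1 ≠ w3 ∧ w1 ≠ w4 ∧ w1 ≠ w5 ∧ w2 ≠ w3 ∧ w2 ≠ w4 ∧ w2 ≠ w5 ∧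
      w3 ≠ w4 ∧ w3 ≠ w5 ∧ w4 ≠ w5 ∧
      G.Adj w1 w2 ∧ G.Adj w2 w3 ∧ G.Adj w1 w4 ∧ G.Adj w2 w4 ∧
      G.Adj w1 w5 ∧ G.Adj w2 w5 ∧ G.Adj w3 w5 ∧ G.Adj w4 w5 ∧
      ¬ G.Adj w1 w3 ∧ ¬ G.Adj w3 w4 := by
  rintro ⟨w1, w2, w3, w4, w5, -, h13, -, -, -, -, -, h34, -, -, a12, a23, a14, a24, a15, a25, a35,
    a45, n13, n34⟩
  obtain ⟨-, hcard, ⟨θ, hθ⟩, -, hind⟩ := hG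
  have hrank := rank_adjPencil_add_eigMult_le (G := G) θ
  exact not_inducesH2 (p := w2) (q := w5) (by omega : (adjPencil G (θ - 1)).rank ≤ 3) hco
    (adj_of_indepNum_eq_two hind)
    ⟨a14, a25, a12, a15, a24.symm, a45, a23.symm, a35, h13, h34.symm, n13, fun e => n34 e.symm⟩
end

section
/- Let n ≥ 5 be odd and let G be the join of a single vertex with the disjoint union of two complete graphs each on (n−1)/2 vertices (so G has n vertices). Then the eigenvalues of the normalized Laplacian ℒ(G), with multiplicity, are: 0 with multiplicity 1, 2/(n−1) with multiplicity 1, and (n+1)/(n−1) with multiplicity n−2. In particular, G has a normalized Laplacian eigenvalue of multiplicity n−2. -/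
open Matrix

theorem joinTwoCliques_adj_center (m : ℕ) (v : Fin m ⊕ Fin m) :
    (joinTwoCliques m).Adj (Sum.inl ()) (Sum.inr v) := by
  simp [joinTwoCliques]

theorem joinTwoCliques_adj_left (m : ℕ) (i j : Fin m) :
    (joinTwoCliques m).Adj (Sum.inr (Sum.inl i)) (Sum.inr (Sum.inl j)) ↔ i ≠ j := by
  simp [joinTwoCliques]

theorem joinTwoCliques_adj_right (m : ℕ) (i j : Fin m) :
    (joinTwoCliques m).Adj (Sum.inr (Sum.inr i)) (Sum.inr (Sum.inr j)) ↔ i ≠ j := by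
  simp [joinTwoCliques]

theorem joinTwoCliques_not_adj_left_right (m : ℕ) (i j : Fin m) :
    ¬ (joinTwoCliques m).Adj (Sum.inr (Sum.inl i)) (Sum.inr (Sum.inr j)) := by
  simp [joinTwoCliques]

theorem joinTwoCliques_not_adj_right_left (m : ℕ) (i j : Fin m) :
    ¬ (joinTwoCliques m).Adj (Sum.inr (Sum.inr i)) (Sum.inr (Sum.inl j)) := by
  simp [joinTwoCliques]

theorem SimpleGraph.degree_eq_sum_ite {V : Type*} [Fintype V] (G : SimpleGraph V)
    [DecidableRel G.Adj] (v : V) : G.degree v = ∑ w, if G.Adj v w then 1 else 0 := by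
  rw [← G.card_neighborFinset_eq_degree, G.neighborFinset_eq_filter, Finset.card_filter]

theorem joinTwoCliques_degree_center (m : ℕ) :
    (joinTwoCliques m).degree (Sum.inl ()) = 2 * m := by
  rw [SimpleGraph.degree_eq_sum_ite, Fintype.sum_sum_type]
  simp only [joinTwoCliques_adj_center]
  simp [two_mul]

theorem joinTwoCliques_degree_left (m : ℕ) (i : Fin m) :
    (joinTwoCliques m).degree (Sum.inr (Sum.inl i)) = m := by
  have := i.pos
  rw [SimpleGraph.degree_eq_sum_ite, Fintype.sum_sum_type, Fintype.sum_sum_type]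
  simp only [(joinTwoCliques_adj_center m _).symm, joinTwoCliques_adj_left,
    joinTwoCliques_not_adj_left_right, Finset.sum_boole, Finset.filter_ne]
  simp
  omega

theorem joinTwoCliques_degree_right (m : ℕ) (i : Fin m) :
    (joinTwoCliques m).degree (Sum.inr (Sum.inr i)) = m := by
  have := i.pos
  rw [SimpleGraph.degree_eq_sum_ite, Fintype.sum_sum_type, Fintype.sum_sum_type]
  simp only [(joinTwoCliques_adj_center m _).symm, joinTwoCliques_adj_right,
    joinTwoCliques_not_adj_right_left, Finset.sum_boole, Finset.filter_ne]
  simp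
  omega

theorem sqrt_two_mul_mul_self (m : ℕ) : √(2 * (m : ℝ) * m) = √2 * m := by
  rw [mul_assoc, Real.sqrt_mul (by norm_num), Real.sqrt_mul_self (by positivity)]

theorem sum_ite_eq_one_else {m : ℕ} (i : Fin m) (c : ℝ) (x : Fin m → ℝ) :
    ∑ j, (if i = j then 1 else c) * x j = x i + c * (∑ j, x j - x i) := by
  have h : ∀ j, (if i = j then 1 else c) * x j = c * x j + if i = j then (1 - c) * x j else 0 := by
    intro j; split_ifs <;> ring
  simp only [h, Finset.sum_add_distrib, ← Finset.mul_sum, Finset.sum_ite_eq, Finset.mem_univ,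
    if_true]
  ring

theorem normLap_joinTwoCliques_mulVec_center (m : ℕ) (x : Unit ⊕ (Fin m ⊕ Fin m) → ℝ) :
    (normLap (joinTwoCliques m) *ᵥ x) (Sum.inl ()) = x (Sum.inl ()) -
      (∑ i, x (Sum.inr (Sum.inl i)) + ∑ i, x (Sum.inr (Sum.inr i))) / (√2 * m) := by
  simp only [mulVec, dotProduct, normLap, of_apply, Fintype.sum_sum_type, Finset.univ_unique,
    Finset.sum_singleton, joinTwoCliques_adj_center, joinTwoCliques_degree_center,
    joinTwoCliques_degree_left, joinTwoCliques_degree_right, PUnit.default_eq_unit, if_true,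
    reduceCtorEq, if_false, Nat.cast_mul, Nat.cast_ofNat, sqrt_two_mul_mul_self, ← Finset.mul_sum]
  ring

theorem normLap_joinTwoCliques_mulVec_left (m : ℕ) (x : Unit ⊕ (Fin m ⊕ Fin m) → ℝ) (i : Fin m) :
    (normLap (joinTwoCliques m) *ᵥ x) (Sum.inr (Sum.inl i)) = x (Sum.inr (Sum.inl i)) -
      (∑ j, x (Sum.inr (Sum.inl j)) - x (Sum.inr (Sum.inl i))) / m
      - x (Sum.inl ()) / (√2 * m) := by
  have h (j : Fin m) : (if i = j then (1 : ℝ) else if i ≠ j then -1 / m else 0)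
      = if i = j then 1 else (-1 / m : ℝ) := by split_ifs <;> simp_all
  simp only [mulVec, dotProduct, normLap, of_apply, Fintype.sum_sum_type, Finset.univ_unique,
    Finset.sum_singleton, (joinTwoCliques_adj_center m _).symm, joinTwoCliques_degree_center,
    joinTwoCliques_degree_left, joinTwoCliques_degree_right, PUnit.default_eq_unit, if_true,
    joinTwoCliques_adj_left, joinTwoCliques_not_adj_left_right, Sum.inr.injEq, Sum.inl.injEq,
    reduceCtorEq, if_false, Nat.cast_mul, Nat.cast_ofNat, mul_comm (m : ℝ) (2 * m),
    sqrt_two_mul_mul_self, Real.sqrt_mul_self (Nat.cast_nonneg m), h, sum_ite_eq_one_else,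
    zero_mul, Finset.sum_const_zero]
  ring

theorem normLap_joinTwoCliques_mulVec_right (m : ℕ) (x : Unit ⊕ (Fin m ⊕ Fin m) → ℝ) (i : Fin m) :
    (normLap (joinTwoCliques m) *ᵥ x) (Sum.inr (Sum.inr i)) = x (Sum.inr (Sum.inr i)) -
      (∑ j, x (Sum.inr (Sum.inr j)) - x (Sum.inr (Sum.inr i))) / m
      - x (Sum.inl ()) / (√2 * m) := by
  have h (j : Fin m) : (if i = j then (1 : ℝ) else if i ≠ j then -1 / m else 0)
      = if i = j then 1 else (-1 / m : ℝ) := by split_ifs <;> simp_all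
  simp only [mulVec, dotProduct, normLap, of_apply, Fintype.sum_sum_type, Finset.univ_unique,
    Finset.sum_singleton, (joinTwoCliques_adj_center m _).symm, joinTwoCliques_degree_center,
    joinTwoCliques_degree_left, joinTwoCliques_degree_right, PUnit.default_eq_unit, if_true,
    joinTwoCliques_adj_right, joinTwoCliques_not_adj_right_left, Sum.inr.injEq,
    reduceCtorEq, if_false, Nat.cast_mul, Nat.cast_ofNat, mul_comm (m : ℝ) (2 * m),
    sqrt_two_mul_mul_self, Real.sqrt_mul_self (Nat.cast_nonneg m), h, sum_ite_eq_one_else,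
    zero_mul, Finset.sum_const_zero]
  ring

/-- The eigenvector equations of `normLap (joinTwoCliques m)`, with denominators cleared. -/
theorem mem_ker_normLap_joinTwoCliques_iff {m : ℕ} (hm : 0 < m) (μ : ℝ)
    (x : Unit ⊕ (Fin m ⊕ Fin m) → ℝ) :
    x ∈ LinearMap.ker (normLap (joinTwoCliques m) - μ • (1 : Matrix _ _ ℝ)).mulVecLin ↔
      √2 * (m * (1 - μ)) * x (Sum.inl ()) =
        ∑ i, x (Sum.inr (Sum.inl i)) + ∑ i, x (Sum.inr (Sum.inr i)) ∧
      (∀ i, √2 * ((m + 1 - m * μ) * x (Sum.inr (Sum.inl i))) =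
        √2 * ∑ j, x (Sum.inr (Sum.inl j)) + x (Sum.inl ())) ∧
      (∀ i, √2 * ((m + 1 - m * μ) * x (Sum.inr (Sum.inr i))) =
        √2 * ∑ j, x (Sum.inr (Sum.inr j)) + x (Sum.inl ())) := by
  have hm' : (m : ℝ) ≠ 0 := by positivity
  have h2 : √2 ≠ 0 := by positivity
  rw [LinearMap.mem_ker, mulVecLin_apply, sub_mulVec, smul_mulVec, one_mulVec, funext_iff,
    Sum.forall, Sum.forall]
  simp only [Pi.sub_apply, Pi.smul_apply, smul_eq_mul, Pi.zero_apply,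
    normLap_joinTwoCliques_mulVec_left, normLap_joinTwoCliques_mulVec_right]
  refine and_congr ?_ (and_congr (forall_congr' fun i => ?_) (forall_congr' fun i => ?_))
  · rw [Unique.forall_iff]
    simp only [PUnit.default_eq_unit, normLap_joinTwoCliques_mulVec_center]
    field_simp
    constructor <;> intro h <;> linear_combination h
  all_goals
    field_simp
    constructor <;> intro h <;> linear_combination h

/-- Away from the eigenvalue `(m + 1) / m`, eigenvectors are constant on both cliques. -/
theorem exists_const_of_mem_ker_normLap_joinTwoCliques {m : ℕ} (hm : 0 < m) {μ : ℝ}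
    (hμ : (m : ℝ) + 1 - m * μ ≠ 0) {x : Unit ⊕ (Fin m ⊕ Fin m) → ℝ}
    (hx : x ∈ LinearMap.ker (normLap (joinTwoCliques m) - μ • (1 : Matrix _ _ ℝ)).mulVecLin) :
    ∃ a b c : ℝ, x = Sum.elim (fun _ => c) (Sum.elim (fun _ => a) fun _ => b) ∧
      √2 * (1 - μ) * c = a + b ∧ √2 * (1 - m * μ) * a = c ∧ √2 * (1 - m * μ) * b = c := by
  obtain ⟨h1, h2, h3⟩ := (mem_ker_normLap_joinTwoCliques_iff hm μ x).1 hx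
  have hm' : (m : ℝ) ≠ 0 := by positivity
  have hs : √2 ≠ 0 := by positivity
  have ha : ∀ i, x (Sum.inr (Sum.inl i)) = x (Sum.inr (Sum.inl ⟨0, hm⟩)) := fun i =>
    mul_left_cancel₀ hμ (mul_left_cancel₀ hs ((h2 i).trans (h2 _).symm))
  have hb : ∀ i, x (Sum.inr (Sum.inr i)) = x (Sum.inr (Sum.inr ⟨0, hm⟩)) := fun i =>
    mul_left_cancel₀ hμ (mul_left_cancel₀ hs ((h3 i).trans (h3 _).symm))
  have hA : ∑ i, x (Sum.inr (Sum.inl i)) = m * x (Sum.inr (Sum.inl ⟨0, hm⟩)) := by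
    simp [Finset.sum_congr rfl fun i _ => ha i]
  have hB : ∑ i, x (Sum.inr (Sum.inr i)) = m * x (Sum.inr (Sum.inr ⟨0, hm⟩)) := by
    simp [Finset.sum_congr rfl fun i _ => hb i]
  rw [hA, hB] at h1
  have h2 := h2 ⟨0, hm⟩
  have h3 := h3 ⟨0, hm⟩
  rw [hA] at h2
  rw [hB] at h3
  refine ⟨x (Sum.inr (Sum.inl ⟨0, hm⟩)), x (Sum.inr (Sum.inr ⟨0, hm⟩)), x (Sum.inl ()), ?_,
    mul_left_cancel₀ hm' (by linear_combination h1),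
    by linear_combination h2, by linear_combination h3⟩
  ext (_ | i | i)
  · rfl
  · exact ha i
  · exact hb i

theorem eigMult_normLap_joinTwoCliques_zero {m : ℕ} (hm : 0 < m) :
    eigMult (normLap (joinTwoCliques m)) 0 = 1 := by
  have hs : √2 * √2 = 2 := Real.mul_self_sqrt (by norm_num)
  have hm' : (m : ℝ) + 1 - m * 0 ≠ 0 := by rw [mul_zero, sub_zero]; positivity
  have hker : LinearMap.ker (normLap (joinTwoCliques m) - (0 : ℝ) • (1 : Matrix _ _ ℝ)).mulVecLin =
      Submodule.span ℝ {Sum.elim (fun _ => √2) (Sum.elim (fun _ => 1) fun _ => 1)} := by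
    refine le_antisymm (fun x hx => ?_) ?_
    · obtain ⟨a, b, c, rfl, h1, h2, h3⟩ :=
        exists_const_of_mem_ker_normLap_joinTwoCliques hm hm' hx
      have hab : a = b := mul_left_cancel₀ (show √2 ≠ 0 by positivity)
        (by linear_combination h2 - h3)
      refine Submodule.mem_span_singleton.2 ⟨a, ?_⟩
      ext (_ | i | i)
      · simp; linear_combination h2
      · simp
      · simp [hab]
    · rw [Submodule.span_singleton_le_iff_mem, mem_ker_normLap_joinTwoCliques_iff hm]
      simp
      refine ⟨by linear_combination m * hs, fun _ => by ring⟩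
  rw [eigMult, hker, finrank_span_singleton]
  exact fun h => by simpa using congrFun h (Sum.inl ())

theorem eigMult_normLap_joinTwoCliques_inv {m : ℕ} (hm : 0 < m) :
    eigMult (normLap (joinTwoCliques m)) (1 / m) = 1 := by
  have hm' : (m : ℝ) ≠ 0 := by positivity
  have hinv : (m : ℝ) * (1 / m) = 1 := mul_one_div_cancel hm'
  have hker : LinearMap.ker
        (normLap (joinTwoCliques m) - (1 / m : ℝ) • (1 : Matrix _ _ ℝ)).mulVecLin =
      Submodule.span ℝ {Sum.elim (fun _ => 0) (Sum.elim (fun _ => 1) fun _ => -1)} := by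
    refine le_antisymm (fun x hx => ?_) ?_
    · obtain ⟨a, b, c, rfl, h1, h2, h3⟩ :=
        exists_const_of_mem_ker_normLap_joinTwoCliques hm (by simp [hm']) hx
      rw [hinv, sub_self, mul_zero, zero_mul] at h2
      subst h2
      refine Submodule.mem_span_singleton.2 ⟨a, ?_⟩
      ext (_ | i | i)
      · simp
      · simp
      · simp; linear_combination h1
    · rw [Submodule.span_singleton_le_iff_mem, mem_ker_normLap_joinTwoCliques_iff hm]
      simp [hm']
  rw [eigMult, hker, finrank_span_singleton]
  exact fun h => by simpa using congrFun h (Sum.inr (Sum.inl ⟨0, hm⟩))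

/-- The linear conditions cutting out the eigenspace of `(m + 1) / m`. -/
noncomputable def cliqueSums (m : ℕ) : (Unit ⊕ (Fin m ⊕ Fin m) → ℝ) →ₗ[ℝ] ℝ × ℝ where
  toFun x := (√2 * ∑ i, x (Sum.inr (Sum.inl i)) + x (Sum.inl ()),
    √2 * ∑ i, x (Sum.inr (Sum.inr i)) + x (Sum.inl ()))
  map_add' x y := by
    ext <;> simp only [Pi.add_apply, Finset.sum_add_distrib, Prod.mk_add_mk] <;> ring
  map_smul' c x := by
    ext <;> simp only [Pi.smul_apply, smul_eq_mul, ← Finset.mul_sum, RingHom.id_apply,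
      Prod.smul_mk] <;> ring

theorem cliqueSums_surjective {m : ℕ} (hm : 0 < m) : Function.Surjective (cliqueSums m) := by
  rintro ⟨p, q⟩
  have hm' : (m : ℝ) ≠ 0 := by positivity
  refine ⟨Sum.elim (fun _ => 0) (Sum.elim (fun _ => p / (√2 * m)) fun _ => q / (√2 * m)), ?_⟩
  ext <;> simp [cliqueSums] <;> field_simp

theorem eigMult_normLap_joinTwoCliques_top {m : ℕ} (hm : 0 < m) :
    eigMult (normLap (joinTwoCliques m)) ((m + 1) / m) = 2 * m - 1 := by
  have hs : √2 * √2 = 2 := Real.mul_self_sqrt (by norm_num)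
  have hm' : (m : ℝ) ≠ 0 := by positivity
  have h0 : (m : ℝ) + 1 - m * ((m + 1) / m) = 0 := by field_simp; ring
  have h1 : (m : ℝ) * (1 - (m + 1) / m) = -1 := by field_simp; ring
  have hker : LinearMap.ker
        (normLap (joinTwoCliques m) - ((m + 1) / m : ℝ) • (1 : Matrix _ _ ℝ)).mulVecLin =
      LinearMap.ker (cliqueSums m) := by
    ext x
    have : Nonempty (Fin m) := ⟨⟨0, hm⟩⟩
    simp only [mem_ker_normLap_joinTwoCliques_iff hm, h0, h1, LinearMap.mem_ker, cliqueSums,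
      LinearMap.coe_mk, AddHom.coe_mk, Prod.mk_eq_zero, zero_mul, mul_zero, forall_const]
    refine ⟨fun ⟨_, ha, hb⟩ => ⟨ha.symm, hb.symm⟩, fun ⟨ha, hb⟩ => ⟨?_, ha.symm, hb.symm⟩⟩
    refine mul_left_cancel₀ (show √2 ≠ 0 by positivity) ?_
    linear_combination -ha - hb - x (Sum.inl ()) * hs
  have hrank := (cliqueSums m).finrank_range_add_finrank_ker
  rw [LinearMap.range_eq_top.2 (cliqueSums_surjective hm), finrank_top] at hrank
  simp only [Module.finrank_prod, Module.finrank_self, Module.finrank_fintype_fun_eq_card,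
    Fintype.card_sum, Fintype.card_unit, Fintype.card_fin] at hrank
  rw [eigMult, hker]
  omega

theorem eigMult_normLap_joinTwoCliques_eq_zero {m : ℕ} (hm : 0 < m) {μ : ℝ} (h0 : μ ≠ 0)
    (h1 : μ ≠ 1 / m) (h2 : μ ≠ (m + 1) / m) : eigMult (normLap (joinTwoCliques m)) μ = 0 := by
  have hs : √2 * √2 = 2 := Real.mul_self_sqrt (by norm_num)
  have hm' : (m : ℝ) ≠ 0 := by positivity
  have h1' : 1 - m * μ ≠ 0 := fun h => h1 (by field_simp; linear_combination -h)
  have h2' : (m : ℝ) + 1 - m * μ ≠ 0 := fun h => h2 (by field_simp; linear_combination -h)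
  rw [eigMult, Submodule.finrank_eq_zero, Submodule.eq_bot_iff]
  intro x hx
  obtain ⟨a, b, c, rfl, e1, e2, e3⟩ := exists_const_of_mem_ker_normLap_joinTwoCliques hm h2' hx
  have hab : a = b := mul_left_cancel₀ (mul_ne_zero (show √2 ≠ 0 by positivity) h1')
    (e2.trans e3.symm)
  subst hab
  subst e2
  have ha : a = 0 := by
    have : μ * (m + 1 - m * μ) * a = 0 := by
      linear_combination -e1 / 2 + (1 - μ) * (1 - m * μ) * a / 2 * hs
    simpa [h0, h2'] using this
  subst ha
  ext (_ | i | i) <;> simp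

theorem statement16 (n m : ℕ) (hn : 5 ≤ n) (hodd : n = 2 * m + 1) :
    eigMult (normLap (joinTwoCliques m)) 0 = 1 ∧
    eigMult (normLap (joinTwoCliques m)) (2 / ((n : ℝ) - 1)) = 1 ∧
    eigMult (normLap (joinTwoCliques m)) (((n : ℝ) + 1) / ((n : ℝ) - 1)) = n - 2 ∧
    (∀ μ : ℝ, μ ∉ ({0, 2 / ((n : ℝ) - 1), ((n : ℝ) + 1) / ((n : ℝ) - 1)} : Set ℝ) →
      eigMult (normLap (joinTwoCliques m)) μ = 0) ∧
    ∃ μ : ℝ, eigMult (normLap (joinTwoCliques m)) μ = n - 2 := by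
  have hm : 0 < m := by omega
  have hm' : (m : ℝ) ≠ 0 := by positivity
  have hn1 : (n : ℝ) - 1 = 2 * m := by rw [hodd]; push_cast; ring
  have h1 : 2 / ((n : ℝ) - 1) = 1 / m := by rw [hn1]; field_simp
  have h2 : ((n : ℝ) + 1) / ((n : ℝ) - 1) = (m + 1) / m := by
    rw [hn1, hodd]; push_cast; field_simp; ring
  have htop : eigMult (normLap (joinTwoCliques m)) (((n : ℝ) + 1) / ((n : ℝ) - 1)) = n - 2 := by
    rw [h2, eigMult_normLap_joinTwoCliques_top hm]; omega
  refine ⟨eigMult_normLap_joinTwoCliques_zero hm, ?_, htop, fun μ hμ => ?_, _, htop⟩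
  · rw [h1, eigMult_normLap_joinTwoCliques_inv hm]
  · simp only [h1, h2, Set.mem_insert_iff, Set.mem_singleton_iff, not_or] at hμ
    exact eigMult_normLap_joinTwoCliques_eq_zero hm hμ.1 hμ.2.1 hμ.2.2
end
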